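/- For all integers n ≥ 4, r ≥ 1, and m with 1 ≤ m ≤ n−3, in the polynomial ring (ZMod 5)[Y], the polynomial Y^(5^n + 5^(n−1) − 1) divides (r : ZMod 5)·Y^(6·5^(n−1) − 3·5^(n−m−2))·((4Y+1)^(16·5^(n−1) + 2·5^(n−m−2) + 4(r−1)·5^n) + (4Y+1)^(8·5^(n−1) + 5^(n−m−2) + 2(r−1)·5^n)) − (r : ZMod 5)·(2·Y^(6·5^(n−1) − 3·5^(n−m−2)) + 2·Y^(6·5^(n−1) − 2·5^(n−m−2)) + Y^(6·5^(n−1) − 5^(n−m−2))). -/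

import Mathlib

open Polynomial

/-- Frobenius on `4X + 1 = 1 - X` in characteristic `5`. -/
lemma four_mul_X_add_one_pow (k : ℕ) :
    (4 * X + 1 : (ZMod 5)[X]) ^ 5 ^ k = 1 - X ^ 5 ^ k := by
  have h4 : (4 : (ZMod 5)[X]) = -1 := by
    linear_combination (mod_cast CharP.cast_eq_zero (ZMod 5)[X] 5 : (5 : (ZMod 5)[X]) = 0)
  have : Fact (Nat.Prime 5) := ⟨by norm_num⟩
  rw [h4, show (-1 * X + 1 : (ZMod 5)[X]) = 1 - X by ring, sub_pow_char_pow, one_pow]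

/-- Multiples of `5 ^ l` in the exponent of `4X + 1` do not matter modulo `X ^ 5 ^ l`. -/
lemma X_pow_dvd_four_mul_X_add_one_pow_sub_one (l j : ℕ) :
    (X : (ZMod 5)[X]) ^ 5 ^ l ∣ (4 * X + 1) ^ (5 ^ l * j) - 1 := by
  rw [pow_mul, four_mul_X_add_one_pow]
  refine dvd_trans ⟨-1, by ring⟩ (sub_one_dvd_pow_sub_one (1 - X ^ 5 ^ l) j)

/-- Lemma 4.10, second part: for `n ≥ 4`, `r ≥ 1`, `1 ≤ m ≤ n-3`, in `(ZMod 5)[Y]`,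
`Y^(5^n + 5^(n-1) - 1)` divides
`r·Y^(6·5^(n-1)-3·5^(n-m-2))·((4Y+1)^(16·5^(n-1)+2·5^(n-m-2)+4(r-1)·5^n)
    + (4Y+1)^(8·5^(n-1)+5^(n-m-2)+2(r-1)·5^n))
  - r·(2·Y^(6·5^(n-1)-3·5^(n-m-2)) + 2·Y^(6·5^(n-1)-2·5^(n-m-2)) + Y^(6·5^(n-1)-5^(n-m-2)))`. -/
theorem stmt_7 (n r m : ℕ) (hn : 4 ≤ n) (hr : 1 ≤ r) (hm1 : 1 ≤ m) (hm2 : m ≤ n - 3) :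
    (X : Polynomial (ZMod 5)) ^ (5 ^ n + 5 ^ (n - 1) - 1) ∣
      C (r : ZMod 5) * X ^ (6 * 5 ^ (n - 1) - 3 * 5 ^ (n - m - 2)) *
          ((4 * X + 1) ^ (16 * 5 ^ (n - 1) + 2 * 5 ^ (n - m - 2) + 4 * (r - 1) * 5 ^ n)
            + (4 * X + 1) ^ (8 * 5 ^ (n - 1) + 5 ^ (n - m - 2) + 2 * (r - 1) * 5 ^ n))
        - C (r : ZMod 5) * (2 * X ^ (6 * 5 ^ (n - 1) - 3 * 5 ^ (n - m - 2))
            + 2 * X ^ (6 * 5 ^ (n - 1) - 2 * 5 ^ (n - m - 2))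
            + X ^ (6 * 5 ^ (n - 1) - 5 ^ (n - m - 2))) := by
  obtain ⟨k, rfl⟩ : ∃ k, n = k + m + 2 := ⟨n - m - 2, by omega⟩
  rw [show k + m + 2 - m - 2 = k by omega, show k + m + 2 - 1 = k + m + 1 by omega]
  have five : (5 : (ZMod 5)[X]) = 0 :=
    mod_cast CharP.cast_eq_zero (ZMod 5)[X] 5
  have hqQ : 3 * 5 ^ k ≤ 5 ^ (k + m + 1) := by
    rw [add_assoc, pow_add, mul_comm]
    exact Nat.mul_le_mul_left _
      (le_trans (by norm_num) (Nat.pow_le_pow_right (by norm_num) (by omega : 1 ≤ m + 1)))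
  have hN : 5 ^ (k + m + 2) = 5 * 5 ^ (k + m + 1) := by ring
  have h16 := X_pow_dvd_four_mul_X_add_one_pow_sub_one (k + m + 1) (16 + 20 * (r - 1))
  have h8 := X_pow_dvd_four_mul_X_add_one_pow_sub_one (k + m + 1) (8 + 10 * (r - 1))
  have hz := four_mul_X_add_one_pow k
  rw [hN]
  generalize 5 ^ (k + m + 1) = Q at *
  generalize 5 ^ k = q at *
  generalize r - 1 = s at *
  obtain ⟨a, ha⟩ := h16
  obtain ⟨b, hb⟩ := h8
  rw [sub_eq_iff_eq_add] at ha hb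
  rw [show 16 * Q + 2 * q + 4 * s * (5 * Q) = Q * (16 + 20 * s) + q * 2 by ring,
    show 8 * Q + q + 2 * s * (5 * Q) = Q * (8 + 10 * s) + q by ring,
    show 6 * Q - 2 * q = (6 * Q - 3 * q) + q by omega,
    show 6 * Q - q = (6 * Q - 3 * q) + q * 2 by omega,
    pow_add (4 * X + 1), pow_add (4 * X + 1), pow_mul _ q 2, hz, ha, hb,
    pow_add X, pow_add X, pow_mul X q 2]
  refine dvd_trans (pow_dvd_pow X (by omega : _ ≤ (6 * Q - 3 * q) + Q))
    ⟨C (r : ZMod 5) * (a * (1 - X ^ q) ^ 2 + b * (1 - X ^ q)), ?_⟩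
  rw [pow_add]
  linear_combination
    (-(C (r : ZMod 5)) * X ^ (6 * Q - 3 * q) * X ^ q) * five
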